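/- Let d ≥ 2 be an integer, let p ∈ [1, ∞], and let ε ∈ (0, 1). Then there exist an integer N ≤ 2d(1 + 6·d^{1/4}·ε^{−1/2})^{d−1}, vectors a_1, …, a_N ∈ ℝ^d, and reals b_1, …, b_N such that the intersection of halfspaces P = ⋂_{i=1}^N {y ∈ ℝ^d : ⟨a_i, y⟩ ≤ b_i} satisfies {y ∈ ℝ^d : ‖y‖_p ≤ 1} ⊆ P ⊆ {y ∈ ℝ^d : ‖y‖_p ≤ 1 + ε}, where ⟨·,·⟩ denotes the standard Euclidean inner product on ℝ^d. In other words, the closed unit ℓ_p-ball is sandwiched between an intersection of at most 2d(1 + 6·d^{1/4}·ε^{−1/2})^{d−1} closed halfspaces and the closed ℓ_p-ball of radius 1 + ε. -/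

import Mathlib

open MeasureTheory

lemma aux_pow_sub (a b : ℝ) (hb : 0 ≤ b) (hab : b ≤ a) (n : ℕ) :
    a ^ (n + 1) - b ^ (n + 1) ≤ (n + 1) * (a - b) * a ^ n := by
  induction n with
  | zero => simp
  | succ n ih =>
    have h1 : b ^ (n + 1) ≤ a ^ (n + 1) := pow_le_pow_left₀ hb hab _
    have ha : 0 ≤ a := hb.trans hab
    have h2 := mul_le_mul_of_nonneg_left ih ha
    have h3 := mul_le_mul_of_nonneg_right h1 (sub_nonneg.2 hab)
    push_cast
    calc a ^ (n + 1 + 1) - b ^ (n + 1 + 1)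
        = a * (a ^ (n + 1) - b ^ (n + 1)) + b ^ (n + 1) * (a - b) := by ring
      _ ≤ a * ((n + 1) * (a - b) * a ^ n) + a ^ (n + 1) * (a - b) := add_le_add h2 h3
      _ = _ := by ring

/-- Volume bound on separated subsets of the sphere. -/
lemma aux_card (n : ℕ) (h : ℝ) (h0 : 0 < h) (h1 : h < 1)
    (S : Finset (EuclideanSpace ℝ (Fin (n + 1))))
    (hS : ∀ u ∈ S, ‖u‖ = 1) (hsep : ∀ u ∈ S, ∀ v ∈ S, u ≠ v → 2 * h ≤ ‖u - v‖) :
    (S.card : ℝ) ≤ 2 * (n + 1 : ℕ) * (1 + 1 / h) ^ n := by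
  let E := EuclideanSpace ℝ (Fin (n + 1))
  let μ : Measure E := volume
  have hdim : Module.finrank ℝ E = n + 1 := by simp [E]
  have hball : ∀ (x : E) (r : ℝ), 0 ≤ r →
      μ.real (Metric.ball x r) = r ^ (n + 1) * μ.real (Metric.ball 0 1) := by
    intro x r hr
    rw [measureReal_def, Measure.addHaar_ball μ x hr, hdim, ENNReal.toReal_mul,
      ENNReal.toReal_ofReal (by positivity), measureReal_def]
  have hcball : ∀ (x : E) (r : ℝ), 0 ≤ r →
      μ.real (Metric.closedBall x r) = r ^ (n + 1) * μ.real (Metric.ball 0 1) := by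
    intro x r hr
    rw [measureReal_def, Measure.addHaar_closedBall μ x hr, hdim, ENNReal.toReal_mul,
      ENNReal.toReal_ofReal (by positivity), measureReal_def]
  have hpos : 0 < μ.real (Metric.ball (0 : E) 1) := by
    rw [measureReal_def]
    exact ENNReal.toReal_pos (Metric.measure_ball_pos μ _ one_pos).ne' measure_ball_lt_top.ne
  have hdisj : (S : Set E).PairwiseDisjoint (fun u => Metric.ball u h) := by
    intro u hu v hv huv
    apply Metric.ball_disjoint_ball
    have := hsep u hu v hv huv
    rw [dist_eq_norm]; linarith
  have hunion : μ.real (⋃ u ∈ S, Metric.ball u h) = ∑ u ∈ S, μ.real (Metric.ball u h) :=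
    measureReal_biUnion_finset hdisj (fun u _ => measurableSet_ball)
      (fun u _ => measure_ball_lt_top.ne)
  have hsub : (⋃ u ∈ S, Metric.ball u h) ⊆
      Metric.ball (0 : E) (1 + h) \ Metric.closedBall (0 : E) (1 - h) := by
    intro x hx
    simp only [Set.mem_iUnion] at hx
    obtain ⟨u, hu, hx⟩ := hx
    have hx' : ‖x - u‖ < h := by simpa [dist_eq_norm] using hx
    have hu1 := hS u hu
    have e1 : ‖x‖ ≤ ‖x - u‖ + ‖u‖ := by simpa using norm_add_le (x - u) u
    have e2 : ‖u‖ ≤ ‖x - u‖ + ‖x‖ := by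
      have := norm_sub_le x (x - u)
      simp only [sub_sub_cancel] at this
      linarith
    simp only [Set.mem_sdiff, Metric.mem_ball, Metric.mem_closedBall, dist_zero_right]
    constructor <;> linarith
  have hdiff : μ.real (Metric.ball (0 : E) (1 + h) \ Metric.closedBall (0 : E) (1 - h)) =
      μ.real (Metric.ball (0 : E) (1 + h)) - μ.real (Metric.closedBall (0 : E) (1 - h)) := by
    apply measureReal_sdiff
    · exact Metric.closedBall_subset_ball (by linarith)
    · exact measurableSet_closedBall
    · exact (measure_ball_lt_top (μ := μ)).ne
  have hle := measureReal_mono (μ := μ) hsub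
    (ne_top_of_le_ne_top (measure_ball_lt_top (μ := μ)).ne (measure_mono Set.sdiff_subset))
  rw [hunion, hdiff, hball _ _ (by linarith), hcball _ _ (by linarith),
    Finset.sum_congr rfl (fun u _ => hball u h h0.le), Finset.sum_const, nsmul_eq_mul,
    ← sub_mul, ← mul_assoc] at hle
  have hle2 := le_of_mul_le_mul_right hle hpos
  have hp := aux_pow_sub (1 + h) (1 - h) (by linarith) (by linarith) n
  have hh : (0 : ℝ) < h ^ (n + 1) := by positivity
  have : (1 + 1 / h) ^ n = (1 + h) ^ n / h ^ n := by
    rw [← div_pow]; congr 1; field_simp; ring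
  rw [this, ← mul_div_assoc, le_div_iff₀ (by positivity)]
  have h3 : (S.card : ℝ) * h ^ n * h ≤ 2 * (n + 1 : ℕ) * (1 + h) ^ n * h := by
    push_cast
    calc (S.card : ℝ) * h ^ n * h = S.card * h ^ (n + 1) := by ring
      _ ≤ _ := hle2
      _ ≤ _ := hp
      _ = _ := by ring
  exact le_of_mul_le_mul_right h3 h0

lemma aux_net (n : ℕ) (h : ℝ) (h0 : 0 < h) (h1 : h < 1) :
    ∃ S : Finset (EuclideanSpace ℝ (Fin (n + 1))),
      (S.card : ℝ) ≤ 2 * (n + 1 : ℕ) * (1 + 1 / h) ^ n ∧ (∀ u ∈ S, ‖u‖ = 1) ∧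
      ∀ v : EuclideanSpace ℝ (Fin (n + 1)), ‖v‖ = 1 → ∃ u ∈ S, ‖u - v‖ < 2 * h := by
  classical
  let Q : Finset (EuclideanSpace ℝ (Fin (n + 1))) → Prop := fun S =>
    (∀ u ∈ S, ‖u‖ = 1) ∧ (∀ u ∈ S, ∀ v ∈ S, u ≠ v → 2 * h ≤ ‖u - v‖)
  let R : ℕ → Prop := fun k => ∃ S, Q S ∧ S.card = k
  let K := ⌊2 * (n + 1 : ℕ) * (1 + 1 / h) ^ n⌋₊
  have hK : ∀ S, Q S → S.card ≤ K := fun S hS => Nat.le_floor (aux_card n h h0 h1 S hS.1 hS.2)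
  have hR0 : R 0 := ⟨∅, ⟨by simp, by simp⟩, by simp⟩
  obtain ⟨S, hQ, hc⟩ : R (Nat.findGreatest R K) := Nat.findGreatest_spec (Nat.zero_le K) hR0
  refine ⟨S, aux_card n h h0 h1 S hQ.1 hQ.2, hQ.1, ?_⟩
  intro v hv
  by_contra! hcon
  have hvS : v ∉ S := by
    intro hvS
    have := hcon v hvS
    simp at this
    linarith
  have hQ' : Q (insert v S) := by
    constructor
    · intro u hu
      rcases Finset.mem_insert.1 hu with rfl | hu
      · exact hv
      · exact hQ.1 u hu
    · intro u hu w hw huw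
      rcases Finset.mem_insert.1 hu with rfl | hu1 <;> rcases Finset.mem_insert.1 hw with rfl | hw1
      · exact absurd rfl huw
      · rw [norm_sub_rev]; exact hcon w hw1
      · exact hcon u hu1
      · exact hQ.2 u hu1 w hw1 huw
  have := Nat.le_findGreatest (hK _ hQ') (P := R) ⟨_, hQ', rfl⟩
  rw [Finset.card_insert_of_notMem hvS] at this
  omega

lemma aux_G (s x y : ℝ) (hs : 0 ≤ s) (hs2 : s ≤ 1 / 2) (hx : 0 < x) (hy : 0 < y) :
    s * x ^ 2 + (1 - s) * y ^ 2 - x ^ (2 * s) * y ^ (2 * (1 - s)) ≤ (1 - s) * (x - y) ^ 2 := by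
  have h1s : 0 < 1 - s := by linarith
  set G := x ^ (2 * s) * y ^ (2 * (1 - s)) with hG
  have hGp : 0 < G := by positivity
  have hw : 1 / (2 * (1 - s)) ≤ 1 := by
    rw [div_le_one (by positivity)]; linarith
  have key := Real.geom_mean_le_arith_mean2_weighted (w₁ := 1 / (2 * (1 - s)))
    (w₂ := 1 - 1 / (2 * (1 - s))) (p₁ := G) (p₂ := x ^ 2) (by positivity) (by linarith)
    hGp.le (by positivity) (by ring)
  have e : G ^ (1 / (2 * (1 - s))) * (x ^ 2) ^ (1 - 1 / (2 * (1 - s))) = x * y := by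
    rw [hG, Real.mul_rpow (by positivity) (by positivity), ← Real.rpow_mul hx.le,
      ← Real.rpow_mul hy.le, ← Real.rpow_natCast x 2, ← Real.rpow_mul hx.le,
      mul_right_comm, ← Real.rpow_add hx]
    have e1 : 2 * s * (1 / (2 * (1 - s))) + ((2 : ℕ) : ℝ) * (1 - 1 / (2 * (1 - s))) = 1 := by
      push_cast; field_simp; ring
    have e2 : 2 * (1 - s) * (1 / (2 * (1 - s))) = 1 := by field_simp
    rw [e1, e2, Real.rpow_one, Real.rpow_one]
  rw [e] at key
  have key2 := mul_le_mul_of_nonneg_left key (by linarith : 0 ≤ 2 * (1 - s))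
  have e3 : 2 * (1 - s) * (1 / (2 * (1 - s)) * G + (1 - 1 / (2 * (1 - s))) * x ^ 2)
      = G + (1 - 2 * s) * x ^ 2 := by field_simp; ring
  rw [e3] at key2
  nlinarith

lemma aux_G' (s x y : ℝ) (hs : 0 ≤ s) (hs2 : s ≤ 1) (hx : 0 < x) (hy : 0 < y) :
    s * x ^ 2 + (1 - s) * y ^ 2 - x ^ (2 * s) * y ^ (2 * (1 - s)) ≤ (x - y) ^ 2 := by
  rcases le_total s (1 / 2) with h | h
  · have := aux_G s x y hs h hx hy
    nlinarith [sq_nonneg (x - y)]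
  · have := aux_G (1 - s) y x (by linarith) (by linarith) hy hx
    simp only [sub_sub_cancel] at this
    nlinarith [sq_nonneg (x - y)]

/-- The signed power. -/
noncomputable def sp (e x : ℝ) : ℝ := SignType.sign x * |x| ^ e

lemma sp_zero (e : ℝ) : sp e 0 = 0 := by simp [sp]

lemma sp_pos {e x : ℝ} (h : 0 < x) : sp e x = x ^ e := by
  simp [sp, sign_pos h, abs_of_pos h]

lemma sp_neg (e x : ℝ) : sp e (-x) = - sp e x := by
  simp [sp, Left.sign_neg]

lemma sp_sp {e f x : ℝ} (hef : e * f = 1) : sp f (sp e x) = x := by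
  rcases lt_trichotomy x 0 with h | h | h
  · obtain ⟨y, rfl⟩ : ∃ y, x = -y := ⟨-x, by simp⟩
    have hy : 0 < y := by linarith
    rw [sp_neg, sp_neg, sp_pos hy, sp_pos (by positivity), ← Real.rpow_mul hy.le, hef,
      Real.rpow_one]
  · simp [h, sp_zero]
  · rw [sp_pos h, sp_pos (by positivity), ← Real.rpow_mul h.le, hef, Real.rpow_one]

lemma aux_amgm (s x y : ℝ) (hs : 0 ≤ s) (hs2 : s ≤ 1) (hx : 0 < x) (hy : 0 < y) :
    x ^ (2 * s) * y ^ (2 * (1 - s)) ≤ s * x ^ 2 + (1 - s) * y ^ 2 := by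
  have := Real.geom_mean_le_arith_mean2_weighted (w₁ := s) (w₂ := 1 - s) (p₁ := x ^ 2)
    (p₂ := y ^ 2) hs (by linarith) (by positivity) (by positivity) (by ring)
  rw [Real.rpow_mul hx.le, Real.rpow_mul hy.le]
  simpa using this

lemma aux_coord (s u v : ℝ) (hs : 0 ≤ s) (hs2 : s ≤ 1) :
    sp (2 * s) u * sp (2 * (1 - s)) v ≤ s * u ^ 2 + (1 - s) * v ^ 2 ∧
    s * u ^ 2 + (1 - s) * v ^ 2 - sp (2 * s) u * sp (2 * (1 - s)) v ≤ 2 * (u - v) ^ 2 := by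
  have main : ∀ u v : ℝ, 0 < u →
      sp (2 * s) u * sp (2 * (1 - s)) v ≤ s * u ^ 2 + (1 - s) * v ^ 2 ∧
      s * u ^ 2 + (1 - s) * v ^ 2 - sp (2 * s) u * sp (2 * (1 - s)) v ≤ 2 * (u - v) ^ 2 := by
    intro u v hu
    have h1s : 0 ≤ 1 - s := by linarith
    rcases lt_trichotomy v 0 with h | h | h
    · obtain ⟨y, rfl⟩ : ∃ y, v = -y := ⟨-v, by simp⟩
      have hy : 0 < y := by linarith
      have := aux_amgm s u y hs hs2 hu hy
      rw [sp_neg, sp_pos hu, sp_pos hy]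
      have hp : 0 < u ^ (2 * s) * y ^ (2 * (1 - s)) := by positivity
      have p1 : 0 ≤ s * u ^ 2 := by positivity
      have p2 : 0 ≤ (1 - s) * y ^ 2 := by positivity
      constructor
      · rw [neg_sq]; linarith
      · have : 0 < u * y := by positivity
        rw [neg_sq]
        nlinarith [mul_nonneg hs (sq_nonneg y), mul_nonneg h1s (sq_nonneg u)]
    · subst h
      rw [sp_zero]
      constructor
      · simp; positivity
      · simp; nlinarith [sq_nonneg u]
    · rw [sp_pos hu, sp_pos h]
      refine ⟨aux_amgm s u v hs hs2 hu h, ?_⟩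
      have := aux_G' s u v hs hs2 hu h
      nlinarith [sq_nonneg (u - v)]
  rcases lt_trichotomy u 0 with h | h | h
  · have := main (-u) (-v) (by linarith)
    rw [sp_neg, sp_neg] at this
    constructor <;> nlinarith
  · subst h
    rw [sp_zero]
    constructor
    · have : 0 ≤ (1 - s) * v ^ 2 := mul_nonneg (by linarith) (sq_nonneg v)
      simp; linarith
    · simp; nlinarith [sq_nonneg v]
  · exact main u v h

lemma aux_reindex {ι : Type*} [Fintype ι] (d : ℕ) (p : ENNReal) [Fact (1 ≤ p)] (ε B : ℝ)
    (a : ι → (Fin d → ℝ)) (hc : (Fintype.card ι : ℝ) ≤ B)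
    (h1 : ∀ y : PiLp p (fun _ : Fin d => ℝ), ‖y‖ ≤ 1 → ∀ i, ∑ j, a i j * y j ≤ 1)
    (h2 : ∀ y : PiLp p (fun _ : Fin d => ℝ), (∀ i, ∑ j, a i j * y j ≤ 1) → ‖y‖ ≤ 1 + ε) :
    ∃ (N : ℕ) (a : Fin N → (Fin d → ℝ)) (b : Fin N → ℝ),
      (N : ℝ) ≤ B ∧
      (∀ y : PiLp p (fun _ : Fin d => ℝ), ‖y‖ ≤ 1 → ∀ i, ∑ j, a i j * y j ≤ b i) ∧
      (∀ y : PiLp p (fun _ : Fin d => ℝ), (∀ i, ∑ j, a i j * y j ≤ b i) → ‖y‖ ≤ 1 + ε) := by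
  let e := Fintype.equivFin ι
  refine ⟨Fintype.card ι, fun i => a (e.symm i), fun _ => 1, hc,
    fun y hy i => h1 y hy _, fun y hy => h2 y fun i => ?_⟩
  simpa using hy (e i)

/-- For `d ≥ 2`, `p ∈ [1,∞]`, and `ε ∈ (0,1)`, the closed unit `ℓ_p`-ball in `ℝ^d` is
sandwiched between an intersection of at most `2d(1 + 6·d^{1/4}·ε^{−1/2})^{d−1}` closed
halfspaces (with respect to the standard Euclidean inner product) and the closed
`ℓ_p`-ball of radius `1 + ε`. -/
theorem stmt_13 (d : ℕ) (hd : 2 ≤ d) (p : ENNReal) [Fact (1 ≤ p)]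
    (ε : ℝ) (hε0 : 0 < ε) (hε1 : ε < 1) :
    ∃ (N : ℕ) (a : Fin N → (Fin d → ℝ)) (b : Fin N → ℝ),
      (N : ℝ) ≤ 2 * d * (1 + 6 * (d : ℝ) ^ ((1 : ℝ) / 4) / Real.sqrt ε) ^ (d - 1) ∧
      (∀ y : PiLp p (fun _ : Fin d => ℝ), ‖y‖ ≤ 1 → ∀ i, ∑ j, a i j * y j ≤ b i) ∧
      (∀ y : PiLp p (fun _ : Fin d => ℝ), (∀ i, ∑ j, a i j * y j ≤ b i) → ‖y‖ ≤ 1 + ε) := by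
  have hsq : 0 < Real.sqrt ε := Real.sqrt_pos.2 hε0
  have hsq2 : Real.sqrt ε ^ 2 = ε := Real.sq_sqrt hε0.le
  have hsq1 : Real.sqrt ε < 1 := by nlinarith
  by_cases hp : p = ⊤
  · subst hp
    apply aux_reindex (ι := Fin d × Bool) d ⊤ ε _
      (fun i j => if j = i.1 then (if i.2 then 1 else -1) else 0)
    · have : (1 : ℝ) ≤ (1 + 6 * (d : ℝ) ^ ((1 : ℝ) / 4) / Real.sqrt ε) ^ (d - 1) := by
        apply one_le_pow₀
        have : 0 ≤ 6 * (d : ℝ) ^ ((1 : ℝ) / 4) / Real.sqrt ε := by positivity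
        linarith
      simp only [Fintype.card_prod, Fintype.card_fin, Fintype.card_bool]
      push_cast
      have hd0 : (0 : ℝ) ≤ d := by positivity
      nlinarith
    · rintro y hy ⟨i, b⟩
      have hi : |y i| ≤ 1 := (PiLp.norm_apply_le y i).trans hy
      have := abs_le.1 hi
      cases b <;> simp <;> linarith
    · intro y hy
      have : ‖y‖ ≤ 1 := by
        rw [PiLp.norm_eq_ciSup]
        haveI : Nonempty (Fin d) := ⟨⟨0, by omega⟩⟩
        apply ciSup_le
        intro i
        have e1 := hy (i, true)
        have e2 := hy (i, false)
        simp at e1 e2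
        rw [Real.norm_eq_abs, abs_le]
        constructor <;> linarith
      linarith
  obtain ⟨n, rfl⟩ : ∃ n, d = n + 1 := ⟨d - 1, by omega⟩
  set t := p.toReal with ht
  have ht1 : 1 ≤ t := by
    have h1 : (1 : ENNReal) ≤ p := Fact.out
    simpa using ENNReal.toReal_mono hp h1
  have ht0 : 0 < t := by linarith
  obtain ⟨s, hs⟩ : ∃ s, s = 1 - 1 / t := ⟨_, rfl⟩
  have hts : 1 / t ≤ 1 := by rw [div_le_one ht0]; exact ht1
  have hts0 : 0 < 1 / t := by positivity
  have hs0 : 0 ≤ s := by linarith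
  have hs1 : s ≤ 1 := by linarith
  have hnorm : ∀ y : PiLp p (fun _ : Fin (n + 1) => ℝ), ∑ i, sp (t / 2) (y i) ^ 2 = ‖y‖ ^ t := by
    intro y
    rw [PiLp.norm_eq_sum (by rw [← ht]; exact ht0), ← ht,
      ← Real.rpow_mul (by positivity), one_div_mul_cancel ht0.ne', Real.rpow_one]
    refine Finset.sum_congr rfl fun i _ => ?_
    rw [Real.norm_eq_abs]
    by_cases h : y i = 0
    · simp [h, sp_zero, Real.zero_rpow ht0.ne']
    · have hs : ((SignType.sign (y i) : SignType) : ℝ) ^ 2 = 1 := by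
        rcases lt_or_gt_of_ne h with h | h
        · simp [sign_neg h]
        · simp [sign_pos h]
      rw [sp, mul_pow, hs, one_mul, ← Real.rpow_natCast, ← Real.rpow_mul (abs_nonneg _)]
      congr 1; push_cast; ring
  have hinv : ∀ x : ℝ, sp (2 * (1 - s)) (sp (t / 2) x) = x := by
    intro x
    apply sp_sp
    rw [hs]; field_simp; ring
  have hu2 : ∀ u : EuclideanSpace ℝ (Fin (n + 1)), ‖u‖ = 1 → ∑ i, u i ^ 2 = 1 := by
    intro u hu
    have := EuclideanSpace.real_norm_sq_eq u
    rw [← this, hu]; norm_num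
  obtain ⟨S, hSc, hS1, hSn⟩ := aux_net n (Real.sqrt ε / 4) (by positivity) (by linarith)
  apply aux_reindex (ι := S) (n + 1) p ε _ (fun u j => sp (2 * s) (u.1 j))
  · rw [Fintype.card_coe]
    refine hSc.trans ?_
    rw [Nat.add_sub_cancel]
    have hdq : (1 : ℝ) ≤ ((n + 1 : ℕ) : ℝ) ^ ((1 : ℝ) / 4) :=
      Real.one_le_rpow (by exact_mod_cast (by omega)) (by norm_num)
    gcongr 2 * _ * (1 + ?_) ^ n
    rw [one_div_div]
    gcongr
    linarith
  · rintro y hy ⟨u, hu⟩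
    have hle : ∀ j, sp (2 * s) (u j) * y j ≤ s * u j ^ 2 + (1 - s) * sp (t / 2) (y j) ^ 2 := by
      intro j
      have := (aux_coord s (u j) (sp (t / 2) (y j)) hs0 hs1).1
      rwa [hinv] at this
    refine (Finset.sum_le_sum fun j _ => hle j).trans ?_
    rw [Finset.sum_add_distrib, ← Finset.mul_sum, ← Finset.mul_sum, hnorm, hu2 u (hS1 u hu)]
    have := Real.rpow_le_one (norm_nonneg y) hy ht0.le
    nlinarith
  · intro z hz
    by_cases hz0 : ‖z‖ = 0
    · rw [hz0]; linarith
    have hzp : 0 < ‖z‖ := lt_of_le_of_ne (norm_nonneg z) (Ne.symm hz0)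
    let y : PiLp p (fun _ : Fin (n + 1) => ℝ) := ‖z‖⁻¹ • z
    have hy : ‖y‖ = 1 := by
      simp only [y, norm_smul, norm_inv, norm_norm]
      exact inv_mul_cancel₀ hz0
    have hyj : ∀ j, y j = ‖z‖⁻¹ * z j := fun j => by simp [y]
    let v : EuclideanSpace ℝ (Fin (n + 1)) := WithLp.toLp 2 (fun j => sp (t / 2) (y j))
    have hvj : ∀ j, v j = sp (t / 2) (y j) := fun j => rfl
    have hv2 : ∑ j, v j ^ 2 = 1 := by
      simp only [hvj]; rw [hnorm, hy, Real.one_rpow]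
    have hv : ‖v‖ = 1 := by
      have := EuclideanSpace.real_norm_sq_eq v
      rw [hv2] at this
      nlinarith [norm_nonneg v]
    obtain ⟨u, hu, huv⟩ := hSn v hv
    have hle : ∀ j, s * u j ^ 2 + (1 - s) * v j ^ 2 - sp (2 * s) (u j) * y j
        ≤ 2 * (u j - v j) ^ 2 := by
      intro j
      have := (aux_coord s (u j) (v j) hs0 hs1).2
      rwa [hvj, hinv, ← hvj] at this
    have hsum := Finset.sum_le_sum fun j (_ : j ∈ Finset.univ) => hle j
    rw [Finset.sum_sub_distrib, Finset.sum_add_distrib, ← Finset.mul_sum, ← Finset.mul_sum,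
      ← Finset.mul_sum, hv2, hu2 u (hS1 u hu)] at hsum
    have hd2 : ∑ j, (u j - v j) ^ 2 = ‖u - v‖ ^ 2 := by
      rw [EuclideanSpace.real_norm_sq_eq]; simp
    rw [hd2] at hsum
    have hd3 : ‖u - v‖ ^ 2 ≤ ε / 4 := by nlinarith [norm_nonneg (u - v)]
    have hzz := hz ⟨u, hu⟩
    have hyz : ∑ j, sp (2 * s) (u j) * y j = ‖z‖⁻¹ * ∑ j, sp (2 * s) (u j) * z j := by
      rw [Finset.mul_sum]
      exact Finset.sum_congr rfl fun j _ => by rw [hyj]; ring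
    have h5 : 1 - ε / 2 ≤ ‖z‖⁻¹ * 1 := by
      have := mul_le_mul_of_nonneg_left hzz (inv_nonneg.2 hzp.le)
      rw [← hyz] at this
      linarith
    have h6 := mul_le_mul_of_nonneg_left h5 hzp.le
    rw [mul_one, mul_inv_cancel₀ hz0] at h6
    nlinarith
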